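/- Let n ≥ 1, let L > 0, let 0 < α < 1/L, and let f : ℝ^n → ℝ be convex, continuously differentiable, and L-smooth relative to h(x) = Σ_i x_i log x_i on S. Let I ⊆ {1,...,n} be nonempty and set S_I = {x ∈ S : x_i = 0 for all i ∉ I}. Let x^0 ∈ S_I with x^0_i > 0 for all i ∈ I, and for each k ≥ 0 let x^{k+1} be the minimizer over S_I of the function z ↦ ⟨∇f(x^k), z⟩ + (1/α) D(z, x^k). Then D(x^{k+1}, x^k) → 0 as k → ∞. -/

import Mathlib

open Finset Filter Topology

noncomputable def klS (a b : ℝ) : ℝ := if a = 0 then b else a * Real.log (a / b) - a + b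

noncomputable def kl {n : ℕ} (x y : Fin n → ℝ) : ℝ := ∑ i, klS (x i) (y i)

def probSimplex (n : ℕ) : Set (Fin n → ℝ) := {x | (∑ i, x i) = 1 ∧ ∀ i, 0 ≤ x i}

noncomputable def suppF {n : ℕ} (x : Fin n → ℝ) : Finset (Fin n) :=
  Finset.univ.filter (fun i => x i ≠ 0)

noncomputable def l0 {n : ℕ} (x : Fin n → ℝ) : ℕ := (suppF x).card

open InformationTheory in
lemma klS_eq_mul_klFun {a b : ℝ} (h : b = 0 → a = 0) : klS a b = b * klFun (a / b) := by
  unfold klS klFun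
  by_cases hb : b = 0
  · simp [hb, h hb]
  · split_ifs with ha
    · simp [ha]
    · field_simp
      ring

lemma klS_self (a : ℝ) : klS a a = 0 := by
  rw [klS_eq_mul_klFun id]
  by_cases ha : a = 0 <;> simp [ha, InformationTheory.klFun_one]

lemma klS_nonneg {a b : ℝ} (ha : 0 ≤ a) (hb : 0 ≤ b) (h : b = 0 → a = 0) : 0 ≤ klS a b := by
  rw [klS_eq_mul_klFun h]
  exact mul_nonneg hb (InformationTheory.klFun_nonneg (div_nonneg ha hb))

/-- Moving `a` towards `b` along a segment does not increase the divergence. -/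
lemma klS_segment_le {a b t : ℝ} (ha : 0 ≤ a) (hb : 0 ≤ b) (h : b = 0 → a = 0)
    (ht0 : 0 ≤ t) (ht1 : t ≤ 1) : klS ((1 - t) * a + t * b) b ≤ klS a b := by
  have hnn := klS_nonneg ha hb h
  rcases hb.eq_or_lt with rfl | hb'
  · simp [h rfl]
  · have hz : b = 0 → (1 - t) * a + t * b = 0 := fun h' => absurd h' hb'.ne'
    rw [klS_eq_mul_klFun h] at hnn ⊢
    rw [klS_eq_mul_klFun hz]
    have hc := InformationTheory.convexOn_klFun.2 (Set.mem_Ici.2 (div_nonneg ha hb))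
      (Set.mem_Ici.2 zero_le_one) (sub_nonneg.2 ht1) ht0 (by ring)
    have he : ((1 - t) * a + t * b) / b = (1 - t) * (a / b) + t * 1 := by
      field_simp
    simp only [smul_eq_mul, InformationTheory.klFun_one, mul_zero, add_zero] at hc
    rw [he]
    have := mul_le_mul_of_nonneg_left hc hb
    nlinarith

lemma klS_mul_self {b t : ℝ} (hb : 0 < b) (ht : 0 < t) :
    klS (t * b) b = klS 0 b + t * b * (Real.log t - 1) := by
  unfold klS
  rw [if_neg (mul_pos ht hb).ne', if_pos rfl, mul_div_cancel_right₀ _ hb.ne']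
  ring

lemma kl_self {n : ℕ} (x : Fin n → ℝ) : kl x x = 0 := by
  simp [kl, klS_self]

lemma kl_nonneg {n : ℕ} {x y : Fin n → ℝ} (hx : ∀ i, 0 ≤ x i) (hy : ∀ i, 0 ≤ y i)
    (h : ∀ i, y i = 0 → x i = 0) : 0 ≤ kl x y :=
  Finset.sum_nonneg fun i _ => klS_nonneg (hx i) (hy i) (h i)

/-- If `p j = 0 < w j`, moving from `p` towards `w` decreases the divergence from `w`
superlinearly. -/
lemma kl_segment_le {n : ℕ} {p w : Fin n → ℝ} (hp : ∀ i, 0 ≤ p i) (hw : ∀ i, 0 ≤ w i)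
    (h : ∀ i, w i = 0 → p i = 0) {j : Fin n} (hpj : p j = 0) (hwj : 0 < w j)
    {t : ℝ} (ht0 : 0 < t) (ht1 : t ≤ 1) :
    kl ((1 - t) • p + t • w) w ≤ kl p w + t * w j * (Real.log t - 1) := by
  have hs : ∀ i ∈ Finset.univ, klS (((1 - t) • p + t • w) i) (w i) ≤
      klS (p i) (w i) + if i = j then t * w j * (Real.log t - 1) else 0 := by
    intro i _
    simp only [Pi.add_apply, Pi.smul_apply, smul_eq_mul]
    split_ifs with hij
    · subst hij
      rw [hpj, mul_zero, zero_add, klS_mul_self hwj ht0]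
    · rw [add_zero]
      exact klS_segment_le (hp i) (hw i) (h i) ht0.le ht1
  have := Finset.sum_le_sum hs
  rwa [Finset.sum_add_distrib, Finset.sum_ite_eq' Finset.univ j, if_pos (Finset.mem_univ j)] at this

lemma probSimplex_eq_stdSimplex (n : ℕ) : probSimplex n = stdSimplex ℝ (Fin n) := by
  ext x
  exact and_comm

lemma convex_probSimplex (n : ℕ) : Convex ℝ (probSimplex n) :=
  probSimplex_eq_stdSimplex n ▸ convex_stdSimplex ℝ (Fin n)

lemma isCompact_probSimplex (n : ℕ) : IsCompact (probSimplex n) :=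
  probSimplex_eq_stdSimplex n ▸ isCompact_stdSimplex ℝ (Fin n)

/-- A minimizer of a linear function plus a multiple of the divergence from `w`, over the face of
the simplex supported on `I`, is positive wherever `w` is. -/
lemma pos_of_isMin_kl {n : ℕ} {α : ℝ} (hα : 0 < α) (g : (Fin n → ℝ) →L[ℝ] ℝ) {I : Finset (Fin n)}
    {p w : Fin n → ℝ} (hp : p ∈ probSimplex n) (hw : w ∈ probSimplex n)
    (hpI : ∀ i ∉ I, p i = 0) (hwI : ∀ i ∉ I, w i = 0) (hwpos : ∀ i ∈ I, 0 < w i)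
    (hmin : ∀ z ∈ probSimplex n, (∀ i ∉ I, z i = 0) →
      g p + (1 / α) * kl p w ≤ g z + (1 / α) * kl z w) :
    ∀ i ∈ I, 0 < p i := by
  intro j hj
  refine (hp.2 j).lt_of_ne' fun hpj => ?_
  have hwj := hwpos j hj
  set G := g w - g p with hG
  set s := α * |G| / w j with hs
  have hs0 : 0 ≤ s := by positivity
  have ht0 := Real.exp_pos (-s)
  have ht1 : Real.exp (-s) ≤ 1 := Real.exp_le_one_iff.2 (by linarith)
  have hlog : Real.log (Real.exp (-s)) = -s := Real.log_exp _
  generalize Real.exp (-s) = t at ht0 ht1 hlog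
  have hz : (1 - t) • p + t • w ∈ probSimplex n :=
    convex_probSimplex n hp hw (sub_nonneg.2 ht1) ht0.le (by ring)
  have hm := hmin _ hz fun i hi => by simp [hpI i hi, hwI i hi]
  have hsupp : ∀ i, w i = 0 → p i = 0 := fun i hi => hpI i fun hiI => (hwpos i hiI).ne' hi
  have hk := kl_segment_le hp.2 hw.2 hsupp hpj hwj ht0 ht1
  rw [hlog] at hk
  have hg : g ((1 - t) • p + t • w) = g p + t * G := by
    simp only [map_add, map_smul, smul_eq_mul, hG]
    ring
  rw [hg] at hm
  have hk' := mul_le_mul_of_nonneg_left hk (one_div_pos.2 hα).le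
  have he : 1 / α * (kl p w + t * w j * (-s - 1)) =
      1 / α * kl p w - t * |G| - t * (w j / α) := by
    rw [hs]
    field_simp
    ring
  rw [he] at hk'
  have h1 : 0 < t * (w j / α) := by positivity
  have h2 := mul_le_mul_of_nonneg_left (le_abs_self G) ht0.le
  linarith

/-- the successive Bregman divergences vanish in the limit. -/
theorem stmt_9 (n : ℕ) (hn : 1 ≤ n) (L α : ℝ) (hL : 0 < L) (hα0 : 0 < α) (hαL : α < 1 / L)
    (f : (Fin n → ℝ) → ℝ) (hconv : ConvexOn ℝ Set.univ f) (hf : ContDiff ℝ 1 f)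
    (hsmooth : ∀ z ∈ probSimplex n, ∀ w ∈ probSimplex n, suppF z ⊆ suppF w →
      f z ≤ f w + fderiv ℝ f w (z - w) + L * kl z w)
    (I : Finset (Fin n)) (hI : I.Nonempty)
    (X : ℕ → Fin n → ℝ)
    (hX0 : X 0 ∈ probSimplex n) (hX0I : ∀ i ∉ I, X 0 i = 0) (hX0pos : ∀ i ∈ I, 0 < X 0 i)
    (hXmem : ∀ k, X (k + 1) ∈ probSimplex n) (hXI : ∀ k, ∀ i ∉ I, X (k + 1) i = 0)
    (hXmin : ∀ k, ∀ z ∈ probSimplex n, (∀ i ∉ I, z i = 0) →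
      fderiv ℝ f (X k) (X (k + 1)) + (1 / α) * kl (X (k + 1)) (X k) ≤
      fderiv ℝ f (X k) z + (1 / α) * kl z (X k)) :
    Tendsto (fun k => kl (X (k + 1)) (X k)) atTop (nhds 0) := by
  have hmem : ∀ k, X k ∈ probSimplex n := fun k => by
    cases k
    exacts [hX0, hXmem _]
  have hzero : ∀ k, ∀ i ∉ I, X k i = 0 := fun k => by
    cases k
    exacts [hX0I, hXI _]
  have hpos : ∀ k, ∀ i ∈ I, 0 < X k i := by
    intro k
    induction k with
    | zero => exact hX0pos
    | succ k ih =>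
      exact pos_of_isMin_kl hα0 _ (hmem _) (hmem k) (hzero _) (hzero k) ih (hXmin k)
  have hsupp : ∀ k i, X k i = 0 → X (k + 1) i = 0 := fun k i hi =>
    hzero _ i fun hiI => (hpos k i hiI).ne' hi
  have hnn : ∀ k, 0 ≤ kl (X (k + 1)) (X k) := fun k =>
    kl_nonneg (hmem _).2 (hmem k).2 (hsupp k)
  have hc : 0 < 1 / α - L := sub_pos.2 ((lt_one_div hα0 hL).1 hαL)
  have hdesc : ∀ k, (1 / α - L) * kl (X (k + 1)) (X k) ≤ f (X k) - f (X (k + 1)) := by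
    intro k
    have h1 := hsmooth _ (hmem (k + 1)) _ (hmem k) fun i hi => by
      simp only [suppF, Finset.mem_filter, Finset.mem_univ, true_and] at hi ⊢
      exact mt (hsupp k i) hi
    have h2 := hXmin k _ (hmem k) (hzero k)
    rw [kl_self, mul_zero, add_zero] at h2
    rw [map_sub] at h1
    linarith
  have hanti : Antitone fun k => f (X k) := antitone_nat_of_succ_le fun k => by
    have := mul_nonneg hc.le (hnn k)
    linarith [hdesc k]
  have hbdd : BddBelow (Set.range fun k => f (X k)) := by
    refine ((isCompact_probSimplex n).bddBelow_image hf.continuous.continuousOn).mono ?_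
    rintro _ ⟨k, rfl⟩
    exact Set.mem_image_of_mem f (hmem k)
  have hlim := tendsto_atTop_ciInf hanti hbdd
  have hdiff := (hlim.sub (hlim.comp (tendsto_add_atTop_nat 1))).div_const (1 / α - L)
  rw [sub_self, zero_div] at hdiff
  refine squeeze_zero hnn (fun k => ?_) hdiff
  rw [le_div_iff₀ hc, mul_comm]
  exact hdesc k
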